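/- Let $1 < q < \infty$. There exists a constant $C > 0$ (depending only on $d$ and $q$) such that for every locally integrable function $f$ on $\mathbb{R}^d$, every $y \in \mathbb{R}^d$ and every $r > 0$, $\int_{\mathbb{R}^d} (Mf)^q(x)\, \chi_{B(y,r)}(x)\, dx \le C \int_{\mathbb{R}^d} |f(x)|^q\, (M\chi_{B(y,r)})(x)\, dx$. -/

import Mathlib

open MeasureTheory ENNReal Set Metric Filter

noncomputable section

/-- Shorthand for the Euclidean space `ℝ^d`. -/
abbrev Rd (d : ℕ) := EuclideanSpace ℝ (Fin d)

/-- The `L^p` "norm" (with values in `ℝ≥0∞`) of an `ℝ≥0∞`-valued function. -/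
def eLpNormE {α : Type*} [MeasurableSpace α] (g : α → ℝ≥0∞) (p : ℝ≥0∞) (μ : Measure α) :
    ℝ≥0∞ :=
  if p = ∞ then essSup g μ else (∫⁻ x, g x ^ p.toReal ∂μ) ^ (1 / p.toReal)

/-- The discrete `ℓ^p` norm of an `ℝ≥0∞`-valued family. -/
def lpNormE {ι : Type*} (a : ι → ℝ≥0∞) (p : ℝ≥0∞) : ℝ≥0∞ :=
  if p = ∞ then ⨆ k, a k else (∑' k, a k ^ p.toReal) ^ (1 / p.toReal)

/-- The continuous amalgam norm `‖f‖_{q,p,r}` of `f : ℝ^d → E`: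
the `L^p` norm (in `y`) of `y ↦ ‖f · χ_{B(y,r)}‖_{L^q}`. -/
def contAmalgam (d : ℕ) {E : Type*} [NormedAddCommGroup E] (f : Rd d → E)
    (q p : ℝ≥0∞) (r : ℝ) : ℝ≥0∞ :=
  eLpNormE (fun y => eLpNorm ((Metric.ball y r).indicator f) q volume) p volume

/-- The continuous amalgam norm of an `ℝ≥0∞`-valued function. -/
def contAmalgamE (d : ℕ) (g : Rd d → ℝ≥0∞) (q p : ℝ≥0∞) (r : ℝ) : ℝ≥0∞ :=
  eLpNormE (fun y => eLpNormE ((Metric.ball y r).indicator g) q volume) p volume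

/-- The half-open cube `Q_k^r = ∏_i [r kᵢ, r (kᵢ + 1))` indexed by `k ∈ ℤ^d`. -/
def unitCube (d : ℕ) (r : ℝ) (k : Fin d → ℤ) : Set (Rd d) :=
  {x | ∀ i, r * k i ≤ x i ∧ x i < r * (k i + 1)}

/-- The discrete amalgam norm: the `ℓ^p` norm over `k ∈ ℤ^d` of `‖f χ_{Q_k^r}‖_{L^q}`. -/
def discAmalgam (d : ℕ) {E : Type*} [NormedAddCommGroup E] (f : Rd d → E)
    (q p : ℝ≥0∞) (r : ℝ) : ℝ≥0∞ :=
  lpNormE (fun k : Fin d → ℤ => eLpNorm ((unitCube d r k).indicator f) q volume) p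

/-- The class `𝒢_{q,p}` of weight functions: `φ` is positive and measurable on `(0,∞)`,
`t ↦ t^{d/p} φ(t)` is almost decreasing and `t ↦ t^{d/q} φ(t)` is almost increasing
(with the convention `1/∞ = 0`). -/
structure IsGqp (d : ℕ) (q p : ℝ≥0∞) (φ : ℝ → ℝ) : Prop where
  measurable : Measurable φ
  pos : ∀ t : ℝ, 0 < t → 0 < φ t
  almost_decreasing : ∃ C : ℝ, 0 < C ∧ ∀ r s : ℝ, 0 < r → r ≤ s →
    s ^ ((d : ℝ) * (1 / p).toReal) * φ s ≤ C * (r ^ ((d : ℝ) * (1 / p).toReal) * φ r)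
  almost_increasing : ∃ C : ℝ, 0 < C ∧ ∀ r s : ℝ, 0 < r → r ≤ s →
    r ^ ((d : ℝ) * (1 / q).toReal) * φ r ≤ C * (s ^ ((d : ℝ) * (1 / q).toReal) * φ s)

/-- The generalized Fofana norm
`‖f‖_{(L^q,L^p)^φ} = sup_{r>0} φ(r)⁻¹ r^{d(-1/q - 1/p)} ‖f‖_{q,p,r}`. -/
def fofanaNorm (d : ℕ) {E : Type*} [NormedAddCommGroup E] (f : Rd d → E)
    (q p : ℝ≥0∞) (φ : ℝ → ℝ) : ℝ≥0∞ :=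
  ⨆ r : {r : ℝ // 0 < r},
    ENNReal.ofReal ((φ r)⁻¹ * (r : ℝ) ^ ((d : ℝ) * (-(1 / q).toReal - (1 / p).toReal))) *
      contAmalgam d f q p r

/-- The generalized Fofana norm of an `ℝ≥0∞`-valued function. -/
def fofanaNormE (d : ℕ) (g : Rd d → ℝ≥0∞) (q p : ℝ≥0∞) (φ : ℝ → ℝ) : ℝ≥0∞ :=
  ⨆ r : {r : ℝ // 0 < r},
    ENNReal.ofReal ((φ r)⁻¹ * (r : ℝ) ^ ((d : ℝ) * (-(1 / q).toReal - (1 / p).toReal))) *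
      contAmalgamE d g q p r

/-- The discrete variant of the generalized Fofana norm,
`sup_{r>0} φ(r)⁻¹ r^{-d/q} ‖f‖~_{q,p,r}`. -/
def fofanaNormDisc (d : ℕ) {E : Type*} [NormedAddCommGroup E] (f : Rd d → E)
    (q p : ℝ≥0∞) (φ : ℝ → ℝ) : ℝ≥0∞ :=
  ⨆ r : {r : ℝ // 0 < r},
    ENNReal.ofReal ((φ r)⁻¹ * (r : ℝ) ^ (-(d : ℝ) * (1 / q).toReal)) *
      discAmalgam d f q p r

/-- The Hardy–Littlewood maximal function (with values in `ℝ≥0∞`). -/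
def hlMax (d : ℕ) {E : Type*} [NormedAddCommGroup E] (f : Rd d → E) (x : Rd d) : ℝ≥0∞ :=
  ⨆ r : {r : ℝ // 0 < r},
    (volume (Metric.ball x (r : ℝ)))⁻¹ * ∫⁻ y in Metric.ball x (r : ℝ), (‖f y‖₊ : ℝ≥0∞)

/-- Maximal function of an `ℝ≥0∞`-valued function. -/
def hlM (d : ℕ) (g : Rd d → ℝ≥0∞) (x : Rd d) : ℝ≥0∞ :=
  ⨆ r : {r : ℝ // 0 < r},
    (volume (Metric.ball x (r : ℝ)))⁻¹ * ∫⁻ y in Metric.ball x (r : ℝ), g y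

lemma hlM_measurable (d : ℕ) (g : Rd d → ℝ≥0∞) : Measurable (hlM d g) := by
  apply LowerSemicontinuous.measurable
  unfold hlM
  apply lowerSemicontinuous_iSup
  rintro ⟨s, hs⟩
  have hv : ∀ x : Rd d, volume (Metric.ball x s) = volume (Metric.ball (0 : Rd d) s) :=
    fun x => Measure.addHaar_ball_center _ _ _
  intro x t ht
  simp only [hv] at ht ⊢
  -- inner approximation
  let u : ℕ → ℝ := fun n => s - s / (n + 2)
  have hu : Metric.ball x s = ⋃ n : ℕ, Metric.ball x (u n) := by
    ext z
    simp only [mem_iUnion, Metric.mem_ball]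
    constructor
    · intro hz
      obtain ⟨n, hn⟩ := exists_nat_gt (s / (s - dist z x))
      refine ⟨n, ?_⟩
      have h1 : 0 < s - dist z x := by linarith
      rw [div_lt_iff₀ h1] at hn
      have h2 : s / (n + 2) < s - dist z x := by
        rw [div_lt_iff₀ (by positivity)]
        nlinarith
      simp only [u]; linarith
    · rintro ⟨n, hn⟩
      have : 0 < s / ((n : ℝ) + 2) := by positivity
      simp only [u] at hn; linarith
  have hmono : Monotone fun n => Metric.ball x (u n) := by
    intro m n hmn
    apply Metric.ball_subset_ball
    simp only [u]
    gcongr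
  rw [hu, setLIntegral_iUnion_of_directed _ (directed_of_isDirected_le hmono), ENNReal.mul_iSup,
    gt_iff_lt, lt_iSup_iff] at ht
  obtain ⟨n, hn⟩ := ht
  have hpos : 0 < s / ((n : ℝ) + 2) := by positivity
  filter_upwards [Metric.ball_mem_nhds x hpos] with x' hx'
  refine hn.trans_le ?_
  gcongr
  intro z hz
  rw [Metric.mem_ball] at *
  have := dist_triangle z x x'
  rw [dist_comm x x'] at this
  simp only [u] at hz; linarith

lemma ball_weight (d : ℕ) (y : Rd d) (r : ℝ) (z : Rd d) (s : ℝ) (hs : 0 < s) :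
    (volume (Metric.ball z s))⁻¹ * volume.restrict (Metric.ball y r) (Metric.ball z s) ≤
      hlMax d ((Metric.ball y r).indicator fun _ => (1 : ℂ)) z := by
  unfold hlMax
  refine le_trans ?_ (le_iSup _ (⟨s, hs⟩ : {r : ℝ // 0 < r}))
  gcongr
  apply le_of_eq
  have : ∀ w, (‖(Metric.ball y r).indicator (fun _ => (1 : ℂ)) w‖₊ : ℝ≥0∞) =
      (Metric.ball y r).indicator 1 w := by
    intro w
    by_cases h : w ∈ Metric.ball y r <;> simp [h]
  simp only [this]
  rw [lintegral_indicator_one measurableSet_ball, Measure.restrict_apply measurableSet_ball,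
    Measure.restrict_apply measurableSet_ball, inter_comm]

lemma weak_bdd (d : ℕ) (μ : Measure (Rd d)) (W g : Rd d → ℝ≥0∞)
    (hW : ∀ z s, 0 < s → (volume (Metric.ball z s))⁻¹ * μ (Metric.ball z s) ≤ W z)
    (t : ℝ≥0∞) (R : ℝ) :
    t * μ {x | ∃ s, 0 < s ∧ s ≤ R ∧
      t < (volume (Metric.ball x s))⁻¹ * ∫⁻ y in Metric.ball x s, g y} ≤
      ENNReal.ofReal (7 ^ d) * ∫⁻ x, g x * W x := by
  set A := {x | ∃ s, 0 < s ∧ s ≤ R ∧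
      t < (volume (Metric.ball x s))⁻¹ * ∫⁻ y in Metric.ball x s, g y} with hA
  have hex : ∀ x, ∃ s, x ∈ A → 0 < s ∧ s ≤ R ∧
      t < (volume (Metric.ball x s))⁻¹ * ∫⁻ y in Metric.ball x s, g y := by
    intro x
    by_cases h : x ∈ A
    · obtain ⟨s, hs⟩ := h
      exact ⟨s, fun _ => hs⟩
    · exact ⟨0, fun h' => absurd h' h⟩
  choose ρ hρ using hex
  obtain ⟨u, huA, hdisj, hcov⟩ := Vitali.exists_disjoint_subfamily_covering_enlargement_closedBall
    A (fun x : Rd d => x) ρ R (fun a ha => (hρ a ha).2.1) 5 (by norm_num)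
  have hdisj' : u.PairwiseDisjoint fun a => Metric.ball a (ρ a) :=
    hdisj.mono fun a => Metric.ball_subset_closedBall
  have hcount : u.Countable := hdisj'.countable_of_isOpen (fun _ _ => Metric.isOpen_ball)
    (fun a ha => ⟨a, Metric.mem_ball_self (hρ a (huA ha)).1⟩)
  have hsub : A ⊆ ⋃ b ∈ u, Metric.ball b (6 * ρ b) := by
    intro a ha
    obtain ⟨b, hb, hab⟩ := hcov a ha
    have h1 := hab (Metric.mem_closedBall_self (hρ a ha).1.le)
    have h2 := (hρ b (huA hb)).1
    simp only [mem_iUnion, Metric.mem_ball]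
    refine ⟨b, hb, ?_⟩
    rw [Metric.mem_closedBall] at h1
    linarith
  have key : ∀ b ∈ u, t * μ (Metric.ball b (6 * ρ b)) ≤
      ENNReal.ofReal (7 ^ d) * ∫⁻ x in Metric.ball b (ρ b), g x * W x := by
    intro b hb
    obtain ⟨hs, -, ht⟩ := hρ b (huA hb)
    set s := ρ b
    set V := volume (Metric.ball b s) with hV
    have hV0 : V ≠ 0 := (Metric.measure_ball_pos _ _ hs).ne'
    have hVt : V ≠ ∞ := measure_ball_lt_top.ne
    set K := ENNReal.ofReal (7 ^ d) with hK
    have hK0 : K ≠ 0 := by rw [hK]; simp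
    have hKt : K ≠ ∞ := ENNReal.ofReal_ne_top
    have hvol : ∀ z : Rd d, volume (Metric.ball z (7 * s)) = K * V := by
      intro z
      rw [Measure.addHaar_ball_mul_of_pos _ _ (by norm_num), hV,
        Measure.addHaar_ball_center _ b s]
      simp [hK]
    have hc : ∀ z ∈ Metric.ball b s, (K * V)⁻¹ * μ (Metric.ball b (6 * s)) ≤ W z := by
      intro z hz
      refine le_trans ?_ (hW z (7 * s) (by positivity))
      rw [hvol]
      gcongr
      apply Metric.ball_subset_ball'
      rw [Metric.mem_ball, dist_comm] at hz
      linarith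
    set m := μ (Metric.ball b (6 * s))
    calc t * m ≤ (V⁻¹ * ∫⁻ y in Metric.ball b s, g y) * m := by gcongr
      _ = K * (((K * V)⁻¹ * m) * ∫⁻ y in Metric.ball b s, g y) := by
        rw [ENNReal.mul_inv (Or.inl hK0) (Or.inl hKt)]
        calc _ = (K * K⁻¹) * ((V⁻¹ * ∫⁻ y in Metric.ball b s, g y) * m) := by
              rw [ENNReal.mul_inv_cancel hK0 hKt, one_mul]
          _ = _ := by ring
      _ ≤ K * ∫⁻ y in Metric.ball b s, ((K * V)⁻¹ * m) * g y := by
        gcongr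
        exact lintegral_const_mul_le _ _
      _ ≤ K * ∫⁻ y in Metric.ball b s, g y * W y := by
        gcongr 1
        apply setLIntegral_mono' measurableSet_ball
        intro z hz
        rw [mul_comm]
        gcongr
        exact hc z hz
  have := hcount.to_subtype
  calc t * μ A ≤ t * ∑' b : u, μ (Metric.ball (b : Rd d) (6 * ρ b)) := by
        gcongr
        refine (measure_mono hsub).trans ?_
        exact measure_biUnion_le _ hcount _
    _ = ∑' b : u, t * μ (Metric.ball (b : Rd d) (6 * ρ b)) := ENNReal.tsum_mul_left.symm
    _ ≤ ∑' b : u, ENNReal.ofReal (7 ^ d) * ∫⁻ x in Metric.ball (b : Rd d) (ρ b), g x * W x :=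
        ENNReal.tsum_le_tsum fun b => key b b.2
    _ = ENNReal.ofReal (7 ^ d) * ∑' b : u, ∫⁻ x in Metric.ball (b : Rd d) (ρ b), g x * W x :=
        ENNReal.tsum_mul_left
    _ = ENNReal.ofReal (7 ^ d) * ∫⁻ x in ⋃ b ∈ u, Metric.ball b (ρ b), g x * W x := by
        rw [lintegral_biUnion hcount (fun _ _ => measurableSet_ball) hdisj']
    _ ≤ _ := by
        gcongr
        exact Measure.restrict_le_self

lemma weak (d : ℕ) (μ : Measure (Rd d)) (W g : Rd d → ℝ≥0∞)
    (hW : ∀ z s, 0 < s → (volume (Metric.ball z s))⁻¹ * μ (Metric.ball z s) ≤ W z)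
    (t : ℝ≥0∞) :
    t * μ {x | t < hlM d g x} ≤ ENNReal.ofReal (7 ^ d) * ∫⁻ x, g x * W x := by
  have h : {x | t < hlM d g x} = ⋃ R : ℕ, {x | ∃ s, 0 < s ∧ s ≤ (R : ℝ) ∧
      t < (volume (Metric.ball x s))⁻¹ * ∫⁻ y in Metric.ball x s, g y} := by
    ext x
    simp only [hlM, mem_ofPred_eq, lt_iSup_iff, mem_iUnion]
    constructor
    · rintro ⟨⟨s, hs⟩, h⟩
      obtain ⟨R, hR⟩ := exists_nat_ge s
      exact ⟨R, s, hs, hR, h⟩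
    · rintro ⟨R, s, hs, hR, h⟩
      exact ⟨⟨s, hs⟩, h⟩
  rw [h, Monotone.measure_iUnion, ENNReal.mul_iSup]
  · exact iSup_le fun R => weak_bdd d μ W g hW t R
  · rintro m n hmn x ⟨s, hs, hR, h⟩
    exact ⟨s, hs, hR.trans (by exact_mod_cast hmn), h⟩

lemma weak_trunc (d : ℕ) (μ : Measure (Rd d)) (W g : Rd d → ℝ≥0∞)
    (hW : ∀ z s, 0 < s → (volume (Metric.ball z s))⁻¹ * μ (Metric.ball z s) ≤ W z)
    (t : ℝ≥0∞) :
    t * μ {x | 2 * t < hlM d g x} ≤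
      ENNReal.ofReal (7 ^ d) * ∫⁻ x, {x | t < g x}.indicator g x * W x := by
  refine le_trans ?_ (weak d μ W _ hW t)
  refine mul_le_mul_right (measure_mono ?_) t
  intro x h
  by_contra hcon
  simp only [mem_ofPred_eq, not_lt] at hcon h
  refine absurd h (not_lt.mpr ?_)
  have hg : ∀ z, g z ≤ {x | t < g x}.indicator g z + t := by
    intro z
    by_cases hz : t < g z
    · simp [hz]
    · simp [hz, not_lt.mp hz]
  unfold hlM
  apply iSup_le
  rintro ⟨s, hs⟩
  have hV0 : volume (Metric.ball x s) ≠ 0 := (Metric.measure_ball_pos _ _ hs).ne'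
  have hVt : volume (Metric.ball x s) ≠ ∞ := measure_ball_lt_top.ne
  calc _ ≤ (volume (Metric.ball x s))⁻¹ *
        ∫⁻ y in Metric.ball x s, ({x | t < g x}.indicator g y + t) := by
        gcongr with z
        exact hg z
    _ = (volume (Metric.ball x s))⁻¹ * (∫⁻ y in Metric.ball x s, {x | t < g x}.indicator g y) +
        t := by
        rw [lintegral_add_right _ measurable_const, mul_add, setLIntegral_const,
          mul_comm t, ← mul_assoc, ENNReal.inv_mul_cancel hV0 hVt, one_mul]
    _ ≤ t + t := by
        gcongr
        refine le_trans ?_ hcon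
        exact le_iSup (fun r : {r : ℝ // 0 < r} => (volume (Metric.ball x (r : ℝ)))⁻¹ *
          ∫⁻ y in Metric.ball x (r : ℝ), {x | t < g x}.indicator g y) ⟨s, hs⟩
    _ = 2 * t := (two_mul t).symm

lemma zpow_ne (j : ℤ) : (2 : ℝ≥0∞) ^ j ≠ 0 ∧ (2 : ℝ≥0∞) ^ j ≠ ∞ :=
  ⟨(ENNReal.zpow_pos (by norm_num) (by norm_num) j).ne',
    (ENNReal.zpow_lt_top (by norm_num) (by norm_num) j).ne⟩

lemma dyadic_lower (q : ℝ) (hq : 1 < q) (a : ℝ≥0∞) :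
    a ^ q ≤ 4 ^ q * ∑' j : ℤ, ((2 : ℝ≥0∞) ^ j) ^ q *
      (if 2 * (2 : ℝ≥0∞) ^ j < a then 1 else 0) := by
  have hq0 : 0 < q := by linarith
  rcases eq_or_ne a 0 with rfl | ha0
  · simp [hq0]
  rcases eq_or_ne a ∞ with rfl | hat
  · have : ∑' j : ℤ, ((2 : ℝ≥0∞) ^ j) ^ q *
      (if 2 * (2 : ℝ≥0∞) ^ j < ∞ then 1 else 0) = ∞ := by
      rw [eq_top_iff]
      have h1 : (∞ : ℝ≥0∞) = ∑' n : ℕ, (1 : ℝ≥0∞) := by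
        rw [ENNReal.tsum_const_eq_top_of_ne_zero one_ne_zero]
      refine h1.le.trans ?_
      refine le_trans ?_ (ENNReal.tsum_comp_le_tsum_of_injective Nat.cast_injective _)
      apply ENNReal.tsum_le_tsum
      intro n
      rw [if_pos (ENNReal.mul_lt_top (by norm_num) (zpow_ne _).2.lt_top), mul_one]
      apply ENNReal.one_le_rpow _ hq0
      rw [zpow_natCast]
      exact one_le_pow₀ (by norm_num)
    rw [this, ENNReal.mul_top]
    · exact le_top
    · simp
  obtain ⟨n, hn1, hn2⟩ := ENNReal.exists_mem_Ioc_zpow ha0 hat (y := 2) (by norm_num) (by norm_num)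
  have e : (2 : ℝ≥0∞) ^ n = 2 * 2 ^ (n - 1) := by
    have := ENNReal.zpow_add (x := 2) (by norm_num) (by norm_num) 1 (n - 1)
    rw [zpow_one] at this
    rw [← this]; congr 1; ring
  have e' : (2 : ℝ≥0∞) ^ (n + 1) = 4 * 2 ^ (n - 1) := by
    rw [ENNReal.zpow_add (by norm_num) (by norm_num), e, zpow_one, mul_comm, ← mul_assoc]
    norm_num
  calc a ^ q ≤ (4 * 2 ^ (n - 1)) ^ q := by
        rw [← e']; gcongr
    _ = 4 ^ q * ((2 ^ (n - 1)) ^ q * (if 2 * (2 : ℝ≥0∞) ^ (n - 1) < a then 1 else 0)) := by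
        rw [← e, if_pos hn1, mul_one, ENNReal.mul_rpow_of_nonneg _ _ hq0.le]
    _ ≤ _ := by
        gcongr
        exact ENNReal.le_tsum (f := fun j : ℤ => ((2 : ℝ≥0∞) ^ j) ^ q *
          (if 2 * (2 : ℝ≥0∞) ^ j < a then 1 else 0)) (n - 1)

lemma dyadic_upper (s : ℝ) (hs : 0 < s) (a : ℝ≥0∞) (hat : a ≠ ∞) :
    ∑' j : ℤ, ((2 : ℝ≥0∞) ^ j) ^ s * (if (2 : ℝ≥0∞) ^ j < a then 1 else 0) ≤
      (1 - (2⁻¹ : ℝ≥0∞) ^ s)⁻¹ * a ^ s := by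
  rcases eq_or_ne a 0 with rfl | ha0
  · simp
  obtain ⟨n, hn1, hn2⟩ := ENNReal.exists_mem_Ioc_zpow ha0 hat (y := 2) (by norm_num) (by norm_num)
  have hinj : Function.Injective fun i : ℕ => n - (i : ℤ) := by
    intro i j h
    simp only at h
    omega
  rw [← hinj.tsum_eq]
  · calc _ ≤ ∑' i : ℕ, ((2 : ℝ≥0∞) ^ n) ^ s * ((2⁻¹ : ℝ≥0∞) ^ s) ^ i := by
          apply ENNReal.tsum_le_tsum
          intro i
          have : ((2 : ℝ≥0∞) ^ (n - (i : ℤ))) ^ s =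
              ((2 : ℝ≥0∞) ^ n) ^ s * ((2⁻¹ : ℝ≥0∞) ^ s) ^ i := by
            rw [sub_eq_add_neg, ENNReal.zpow_add (by norm_num) (by norm_num),
              ENNReal.mul_rpow_of_nonneg _ _ hs.le, ENNReal.zpow_neg, zpow_natCast,
              ← ENNReal.rpow_natCast (2⁻¹ ^ s), ← ENNReal.rpow_mul, mul_comm s,
              ENNReal.rpow_mul, ENNReal.rpow_natCast, ENNReal.inv_pow]
          rw [← this]
          split_ifs <;> simp
      _ = (1 - (2⁻¹ : ℝ≥0∞) ^ s)⁻¹ * ((2 : ℝ≥0∞) ^ n) ^ s := by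
          rw [ENNReal.tsum_mul_left, ENNReal.tsum_geometric, mul_comm]
      _ ≤ _ := by gcongr
  · intro j hj
    have hj' : (2 : ℝ≥0∞) ^ j < a := by
      by_contra h
      simp [h] at hj
    have hjn : j ≤ n := by
      by_contra! h
      have h2 : (2 : ℝ≥0∞) ^ (n + 1) ≤ 2 ^ j := ENNReal.zpow_le_of_le (by norm_num) (by omega)
      exact absurd hj' (not_lt.mpr (hn2.trans h2))
    exact ⟨(n - j).toNat, by simp only; omega⟩

lemma strong (d : ℕ) (q : ℝ) (hq : 1 < q) (μ : Measure (Rd d)) (W g : Rd d → ℝ≥0∞)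
    (hW : ∀ z s, 0 < s → (volume (Metric.ball z s))⁻¹ * μ (Metric.ball z s) ≤ W z)
    (hWm : Measurable W) (hg : AEMeasurable g volume) (hgt : ∀ x, g x ≠ ∞) :
    ∫⁻ x, hlM d g x ^ q ∂μ ≤
      (4 ^ q * ENNReal.ofReal (7 ^ d) * (1 - (2⁻¹ : ℝ≥0∞) ^ (q - 1))⁻¹) *
        ∫⁻ x, g x ^ q * W x := by
  have hm := hlM_measurable d g
  set K := ENNReal.ofReal (7 ^ d)
  set c := (1 - (2⁻¹ : ℝ≥0∞) ^ (q - 1))⁻¹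
  have hms : ∀ j : ℤ, MeasurableSet {x | 2 * (2 : ℝ≥0∞) ^ j < hlM d g x} :=
    fun j => measurableSet_lt measurable_const hm
  have hterm : ∀ j : ℤ, ((2 : ℝ≥0∞) ^ j) ^ q * μ {x | 2 * (2 : ℝ≥0∞) ^ j < hlM d g x} ≤
      K * ∫⁻ x, ((2 : ℝ≥0∞) ^ j) ^ (q - 1) *
        ({x | (2 : ℝ≥0∞) ^ j < g x}.indicator g x * W x) := by
    intro j
    have hp := zpow_ne j
    have h := weak_trunc d μ W g hW (2 ^ j)
    have e : ((2 : ℝ≥0∞) ^ j) ^ q = ((2 : ℝ≥0∞) ^ j) ^ (q - 1) * 2 ^ j := by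
      conv_rhs => rw [← ENNReal.rpow_one ((2 : ℝ≥0∞) ^ j), ← ENNReal.rpow_mul, one_mul]
      rw [← ENNReal.rpow_add _ _ hp.1 hp.2]
      simp
    rw [lintegral_const_mul' _ _ (ENNReal.rpow_ne_top_of_nonneg (by linarith) hp.2), e, mul_assoc,
      mul_left_comm K]
    gcongr
  calc ∫⁻ x, hlM d g x ^ q ∂μ
      ≤ ∫⁻ x, 4 ^ q * ∑' j : ℤ, ((2 : ℝ≥0∞) ^ j) ^ q *
          (if 2 * (2 : ℝ≥0∞) ^ j < hlM d g x then 1 else 0) ∂μ :=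
        lintegral_mono fun x => dyadic_lower q hq _
    _ = 4 ^ q * ∑' j : ℤ, ((2 : ℝ≥0∞) ^ j) ^ q * μ {x | 2 * (2 : ℝ≥0∞) ^ j < hlM d g x} := by
        have hmi : ∀ j : ℤ, Measurable fun x =>
            (if 2 * (2 : ℝ≥0∞) ^ j < hlM d g x then (1 : ℝ≥0∞) else 0) :=
          fun j => Measurable.ite (hms j) measurable_const measurable_const
        rw [lintegral_const_mul' _ _ (ENNReal.rpow_ne_top_of_nonneg (by linarith) (by norm_num)),
          lintegral_tsum fun j => ((hmi j).const_mul _).aemeasurable]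
        congr 1
        apply tsum_congr
        intro j
        rw [lintegral_const_mul _ (hmi j), ← lintegral_indicator_one (hms j)]
        congr 2
        ext x
        simp [Set.indicator_apply]
    _ ≤ 4 ^ q * ∑' j : ℤ, K * ∫⁻ x, ((2 : ℝ≥0∞) ^ j) ^ (q - 1) *
        ({x | (2 : ℝ≥0∞) ^ j < g x}.indicator g x * W x) := by
        exact mul_le_mul_right (ENNReal.tsum_le_tsum hterm) _
    _ = 4 ^ q * K * ∫⁻ x, ∑' j : ℤ, ((2 : ℝ≥0∞) ^ j) ^ (q - 1) *
        ({x | (2 : ℝ≥0∞) ^ j < g x}.indicator g x * W x) := by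
        rw [ENNReal.tsum_mul_left, lintegral_tsum, mul_assoc]
        intro j
        refine AEMeasurable.const_mul (AEMeasurable.mul ?_ hWm.aemeasurable) _
        exact hg.indicator₀ (nullMeasurableSet_lt aemeasurable_const hg)
    _ ≤ 4 ^ q * K * ∫⁻ x, c * (g x ^ q * W x) := by
        gcongr with x
        calc _ = (g x * W x) * ∑' j : ℤ, ((2 : ℝ≥0∞) ^ j) ^ (q - 1) *
              (if (2 : ℝ≥0∞) ^ j < g x then 1 else 0) := by
              rw [← ENNReal.tsum_mul_left]
              apply tsum_congr
              intro j
              by_cases h : (2 : ℝ≥0∞) ^ j < g x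
              · simp [h]; ring
              · simp [h]
          _ ≤ (g x * W x) * (c * g x ^ (q - 1)) := by
              gcongr
              exact dyadic_upper _ (by linarith) _ (hgt x)
          _ = c * ((g x * g x ^ (q - 1)) * W x) := by ring
          _ = _ := by
              congr 2
              nth_rewrite 1 [← ENNReal.rpow_one (g x)]
              rw [← ENNReal.rpow_add_of_nonneg _ _ (by norm_num) (by linarith)]
              simp
    _ = _ := by
        have hc : c ≠ ∞ := by
          simp only [c, ne_eq, ENNReal.inv_eq_top, tsub_eq_zero_iff_le, not_le]
          exact ENNReal.rpow_lt_one (by norm_num) (by linarith)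
        rw [lintegral_const_mul' _ _ hc, ← mul_assoc]

/-- Fefferman–Stein type inequality: for `1 < q < ∞` there is `C > 0`
(depending only on `d` and `q`) such that for every locally integrable `f`, every ball
`B(y,r)`: `∫ (Mf)^q χ_{B(y,r)} ≤ C ∫ |f|^q M(χ_{B(y,r)})`. -/
theorem maximal_ball_weight_inequality (d : ℕ) (q : ℝ) (hq : 1 < q) :
    ∃ C : ℝ, 0 < C ∧ ∀ f : Rd d → ℂ, LocallyIntegrable f volume →
      ∀ y : Rd d, ∀ r : ℝ, 0 < r →
        (∫⁻ x in Metric.ball y r, hlMax d f x ^ q) ≤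
          ENNReal.ofReal C *
            ∫⁻ x, (‖f x‖₊ : ℝ≥0∞) ^ q *
              hlMax d ((Metric.ball y r).indicator fun _ => (1 : ℂ)) x := by
  set A : ℝ≥0∞ := 4 ^ q * ENNReal.ofReal (7 ^ d) * (1 - (2⁻¹ : ℝ≥0∞) ^ (q - 1))⁻¹ with hA
  have hAt : A ≠ ∞ := by
    refine ENNReal.mul_ne_top (ENNReal.mul_ne_top
      (ENNReal.rpow_ne_top_of_nonneg (by linarith) (by norm_num)) ENNReal.ofReal_ne_top) ?_
    simp only [ne_eq, ENNReal.inv_eq_top, tsub_eq_zero_iff_le, not_le]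
    exact ENNReal.rpow_lt_one (by norm_num) (by linarith)
  refine ⟨A.toReal + 1, by positivity, ?_⟩
  intro f hf y r hr
  have h := strong d q hq (volume.restrict (Metric.ball y r))
    (hlMax d ((Metric.ball y r).indicator fun _ => (1 : ℂ))) (fun x => (‖f x‖₊ : ℝ≥0∞))
    (fun z s hs => ball_weight d y r z s hs) (hlM_measurable d _)
    hf.aestronglyMeasurable.enorm (fun x => ENNReal.coe_ne_top)
  refine h.trans ?_
  gcongr
  rw [← hA]
  exact (ENNReal.le_ofReal_iff_toReal_le hAt (by positivity)).mpr (by linarith)
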